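/- (Pointwise consistency of the LPS operator with the Navier operator, eq. (2.9).) There exists a constant c > 0, independent of u, x, δ, γ, λ and μ, such that the following holds: if u : ℝ² → ℝ² is four times continuously differentiable, x ∈ ℝ², and M ≥ 0 satisfies ‖D^k u(z)‖ ≤ M for every z in the closed ball of radius 2δ centered at x and every 1 ≤ k ≤ 4, then |ℒ^{LPS}u(x) − (μ Δu(x) + (λ+μ) ∇(∇·u)(x))| ≤ c (|λ−μ| + |μ|) M δ², where Δu is the componentwise Laplacian and ∇(∇·u) the gradient of the divergence of u; i.e. ℒ^{LPS}u(x) equals the local Navier operator of linear elasticity applied to u at x up to an O(δ²) error. -/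

import Mathlib

open MeasureTheory
open scoped RealInnerProductSpace

section taylor
variable {E F : Type*} [NormedAddCommGroup E] [NormedSpace ℝ E]
  [NormedAddCommGroup F] [NormedSpace ℝ F]

lemma lps_L2 {G : E → F} (hG : ContDiff ℝ 2 G) {y : E} {M : ℝ} {h : E}
    (hb : ∀ z ∈ Metric.closedBall y ‖h‖, ‖iteratedFDeriv ℝ 2 G z‖ ≤ M) :
    ‖G (y + h) + G (y - h) - (2:ℝ) • G y‖ ≤ 2 * M * ‖h‖ ^ 2 := by
  have hd : Differentiable ℝ G := hG.differentiable (by norm_num)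
  have hd1 : Differentiable ℝ (fderiv ℝ G) :=
    (hG.fderiv_right (m := 1) (by norm_num)).differentiable (by norm_num)
  have hb' : ∀ z ∈ Metric.closedBall y ‖h‖, ‖fderiv ℝ (fderiv ℝ G) z‖ ≤ M := fun z hz => by
    rw [← norm_iteratedFDeriv_one, norm_iteratedFDeriv_fderiv]
    exact hb z hz
  have key := Convex.norm_image_sub_le_of_norm_hasFDerivWithin_le (𝕜 := ℝ)
    (f := fun v => G (y + v) + G (y - v) - (2:ℝ) • G y)
    (f' := fun v => fderiv ℝ G (y + v) - fderiv ℝ G (y - v))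
    (s := Metric.closedBall (0:E) ‖h‖) (C := M * (2 * ‖h‖)) (x := 0) (y := h)
    (fun v hv => by
      have h1 : HasFDerivAt (fun v => G (y + v)) (fderiv ℝ G (y + v)) v := by
        have := (hd (y + v)).hasFDerivAt.comp v ((hasFDerivAt_id v).const_add y)
        simpa [Function.comp_def] using this
      have h2 : HasFDerivAt (fun v => G (y - v)) (-fderiv ℝ G (y - v)) v := by
        have := (hd (y - v)).hasFDerivAt.comp v ((hasFDerivAt_id v).const_sub y)
        simpa [Function.comp_def] using this
      have := ((h1.add h2).sub_const ((2:ℝ) • G y)).hasFDerivWithinAt (s := Metric.closedBall (0:E) ‖h‖)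
      simpa [sub_eq_add_neg] using this)
    (fun v hv => by
      have hv' : ‖v‖ ≤ ‖h‖ := by simpa using hv
      have M0 : 0 ≤ M := le_trans (norm_nonneg _) (hb y (by simp))
      have := Convex.norm_image_sub_le_of_norm_fderiv_le (𝕜 := ℝ) (f := fderiv ℝ G)
        (s := Metric.closedBall y ‖h‖) (fun z _ => hd1 z)
        (fun z hz => hb' z hz) (convex_closedBall _ _)
        (x := y - v) (y := y + v) (by simpa using hv') (by simpa using hv')
      refine this.trans ?_
      have e : (y + v) - (y - v) = (2:ℝ) • v := by rw [two_smul]; abel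
      rw [e, norm_smul]
      simp only [Real.norm_ofNat]
      gcongr)
    (convex_closedBall _ _) (by simp) (by simp)
  have e0 : G (y + 0) + G (y - 0) - (2:ℝ) • G y = 0 := by simp [two_smul]
  rw [e0, sub_zero, sub_zero] at key
  refine key.trans (le_of_eq (by ring))

lemma lps_L3 {G : E → F} (hG : ContDiff ℝ 3 G) {y : E} {M : ℝ} {h : E}
    (hb : ∀ z ∈ Metric.closedBall y ‖h‖, ‖iteratedFDeriv ℝ 3 G z‖ ≤ M) :
    ‖G (y + h) - G (y - h) - (2:ℝ) • fderiv ℝ G y h‖ ≤ 2 * M * ‖h‖ ^ 3 := by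
  have hd : Differentiable ℝ G := hG.differentiable (by norm_num)
  have M0 : 0 ≤ M := le_trans (norm_nonneg _) (hb y (by simp))
  have key := Convex.norm_image_sub_le_of_norm_hasFDerivWithin_le (𝕜 := ℝ)
    (f := fun v => G (y + v) - G (y - v) - (2:ℝ) • fderiv ℝ G y v)
    (f' := fun v => fderiv ℝ G (y + v) + fderiv ℝ G (y - v) - (2:ℝ) • fderiv ℝ G y)
    (s := Metric.closedBall (0:E) ‖h‖) (C := 2 * M * ‖h‖ ^ 2) (x := 0) (y := h)
    (fun v hv => by
      have h1 : HasFDerivAt (fun v => G (y + v)) (fderiv ℝ G (y + v)) v := by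
        have := (hd (y + v)).hasFDerivAt.comp v ((hasFDerivAt_id v).const_add y)
        simpa [Function.comp_def] using this
      have h2 : HasFDerivAt (fun v => G (y - v)) (-fderiv ℝ G (y - v)) v := by
        have := (hd (y - v)).hasFDerivAt.comp v ((hasFDerivAt_id v).const_sub y)
        simpa [Function.comp_def] using this
      have h3 := ((fderiv ℝ G y).hasFDerivAt (x := v)).const_smul (2:ℝ)
      have := ((h1.sub h2).sub h3).hasFDerivWithinAt (s := Metric.closedBall (0:E) ‖h‖)
      rw [sub_neg_eq_add] at this
      exact this)
    (fun v hv => by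
      have hv' : ‖v‖ ≤ ‖h‖ := by simpa using hv
      have := lps_L2 (G := fderiv ℝ G) (hG.fderiv_right (m := 2) (by norm_num)) (y := y) (h := v)
        (M := M) (fun z hz => norm_iteratedFDeriv_fderiv.le.trans <| hb z (Metric.closedBall_subset_closedBall hv' hz))
      refine this.trans ?_
      gcongr)
    (convex_closedBall _ _) (by simp) (by simp)
  have e0 : G (y + 0) - G (y - 0) - (2:ℝ) • fderiv ℝ G y 0 = 0 := by simp
  rw [e0, sub_zero, sub_zero] at key
  refine key.trans (le_of_eq (by ring))

lemma lps_symm {G : E → F} (hG : ContDiff ℝ 2 G) (y v w : E) :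
    fderiv ℝ (fderiv ℝ G) y v w = fderiv ℝ (fderiv ℝ G) y w v := by
  have := (hG.contDiffAt (x := y)).isSymmSndFDerivAt (by simp)
  exact this v w

lemma lps_L4 {G : E → F} (hG : ContDiff ℝ 4 G) {y : E} {M : ℝ} {h : E}
    (hb : ∀ z ∈ Metric.closedBall y ‖h‖,
      ‖iteratedFDeriv ℝ 4 G z‖ ≤ M) :
    ‖G (y + h) + G (y - h) - (2:ℝ) • G y - fderiv ℝ (fderiv ℝ G) y h h‖ ≤ 2 * M * ‖h‖ ^ 4 := by
  have hd : Differentiable ℝ G := hG.differentiable (by norm_num)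
  have M0 : 0 ≤ M := le_trans (norm_nonneg _) (hb y (by simp))
  have key := Convex.norm_image_sub_le_of_norm_hasFDerivWithin_le (𝕜 := ℝ)
    (f := fun v => G (y + v) + G (y - v) - (2:ℝ) • G y - fderiv ℝ (fderiv ℝ G) y v v)
    (f' := fun v => fderiv ℝ G (y + v) - fderiv ℝ G (y - v)
      - (2:ℝ) • fderiv ℝ (fderiv ℝ G) y v)
    (s := Metric.closedBall (0:E) ‖h‖) (C := 2 * M * ‖h‖ ^ 3) (x := 0) (y := h)
    (fun v hv => by
      have h1 : HasFDerivAt (fun v => G (y + v)) (fderiv ℝ G (y + v)) v := by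
        have := (hd (y + v)).hasFDerivAt.comp v ((hasFDerivAt_id v).const_add y)
        simpa [Function.comp_def] using this
      have h2 : HasFDerivAt (fun v => G (y - v)) (-fderiv ℝ G (y - v)) v := by
        have := (hd (y - v)).hasFDerivAt.comp v ((hasFDerivAt_id v).const_sub y)
        simpa [Function.comp_def] using this
      have h3 := ((fderiv ℝ (fderiv ℝ G) y).hasFDerivAt (x := v)).clm_apply (hasFDerivAt_id v)
      have := (((h1.add h2).sub_const ((2:ℝ) • G y)).sub h3).hasFDerivWithinAt
        (s := Metric.closedBall (0:E) ‖h‖)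
      refine HasFDerivWithinAt.congr_fderiv this ?_
      refine ContinuousLinearMap.ext fun w => ?_
      simp only [_root_.sub_apply, _root_.add_apply, _root_.neg_apply,
        ContinuousLinearMap.comp_apply, ContinuousLinearMap.flip_apply,
        ContinuousLinearMap.id_apply, id, two_smul]
      rw [lps_symm (hG.of_le (by norm_num)) y w v]
      abel)
    (fun v hv => by
      have hv' : ‖v‖ ≤ ‖h‖ := by simpa using hv
      have := lps_L3 (G := fderiv ℝ G) (hG.fderiv_right (m := 3) (by norm_num)) (y := y) (h := v)
        (M := M) (fun z hz => norm_iteratedFDeriv_fderiv.le.trans <| hb z (Metric.closedBall_subset_closedBall hv' hz))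
      refine this.trans ?_
      gcongr)
    (convex_closedBall _ _) (by simp) (by simp)
  have e0 : G (y + 0) + G (y - 0) - (2:ℝ) • G y - fderiv ℝ (fderiv ℝ G) y 0 0 = 0 := by
    simp [two_smul]
  rw [e0, sub_zero, sub_zero] at key
  refine key.trans (le_of_eq (by ring))

/-- Lipschitz bound in the base point for the centred remainder. -/
lemma lps_L5 {G : E → F} (hG : ContDiff ℝ 4 G) {x : E} {M δ : ℝ} {h p q : E}
    (hb : ∀ z ∈ Metric.closedBall x (2 * δ),
      ‖iteratedFDeriv ℝ 4 G z‖ ≤ M)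
    (hh : ‖h‖ ≤ δ) (hp : p ∈ Metric.closedBall x δ) (hq : q ∈ Metric.closedBall x δ) :
    ‖(G (p + h) - G (p - h) - (2:ℝ) • fderiv ℝ G p h) -
      (G (q + h) - G (q - h) - (2:ℝ) • fderiv ℝ G q h)‖ ≤ 2 * M * ‖h‖ ^ 3 * ‖p - q‖ := by
  have hd : Differentiable ℝ G := hG.differentiable (by norm_num)
  have hd1 : Differentiable ℝ (fderiv ℝ G) :=
    (hG.fderiv_right (m := 3) (by norm_num)).differentiable (by norm_num)
  refine Convex.norm_image_sub_le_of_norm_hasFDerivWithin_le (𝕜 := ℝ)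
    (f := fun v => G (v + h) - G (v - h) - (2:ℝ) • fderiv ℝ G v h)
    (f' := fun v => fderiv ℝ G (v + h) - fderiv ℝ G (v - h)
      - (2:ℝ) • fderiv ℝ (fderiv ℝ G) v h)
    (s := Metric.closedBall x δ) (C := 2 * M * ‖h‖ ^ 3) (x := q) (y := p)
    (fun v hv => ?_) (fun v hv => ?_) (convex_closedBall _ _) hq hp
  · have h1 : HasFDerivAt (fun v => G (v + h)) (fderiv ℝ G (v + h)) v := by
      have := (hd (v + h)).hasFDerivAt.comp v ((hasFDerivAt_id v).add_const h)
      simpa [Function.comp_def] using this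
    have h2 : HasFDerivAt (fun v => G (v - h)) (fderiv ℝ G (v - h)) v := by
      have := (hd (v - h)).hasFDerivAt.comp v ((hasFDerivAt_id v).sub_const h)
      simpa [Function.comp_def] using this
    have h3 := ((hd1 v).hasFDerivAt.clm_apply (hasFDerivAt_const h v)).const_smul (2:ℝ)
    have := ((h1.sub h2).sub h3).hasFDerivWithinAt (s := Metric.closedBall x δ)
    refine HasFDerivWithinAt.congr_fderiv this ?_
    refine ContinuousLinearMap.ext fun w => ?_
    simp [lps_symm (hG.of_le (by norm_num)) v w h]
  · refine lps_L3 (G := fderiv ℝ G) (hG.fderiv_right (m := 3) (by norm_num)) (y := v) (h := h)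
        (M := M) (fun z hz => norm_iteratedFDeriv_fderiv.le.trans <| hb z ?_)
    rw [Metric.mem_closedBall] at *
    linarith [dist_triangle z v x]
end taylor

local notation "𝔼" => EuclideanSpace ℝ (Fin 2)


lemma lps_int {δ : ℝ} {γ : ℝ → ℝ} (hγ0 : ∀ r, 0 ≤ γ r)
    (hγδ : ∀ r, δ ≤ r → γ r = 0) (hint : Integrable (fun h : 𝔼 => γ ‖h‖))
    {F : Type*} [NormedAddCommGroup F] [NormedSpace ℝ F]
    {g : 𝔼 → F} (hg : AEStronglyMeasurable g) {C : ℝ}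
    (hC : ∀ h, ‖h‖ ≤ δ → ‖g h‖ ≤ C) : Integrable (fun h => γ ‖h‖ • g h) := by
  refine (hint.mul_const C).mono' (hint.aestronglyMeasurable.smul hg) (.of_forall fun h => ?_)
  rw [norm_smul, Real.norm_of_nonneg (hγ0 _)]
  by_cases hh : δ ≤ ‖h‖
  · simp [hγδ _ hh]
  · exact mul_le_mul_of_nonneg_left (hC h (not_le.1 hh).le) (hγ0 _)

lemma lps_cont {δ : ℝ} {γ : ℝ → ℝ} (hγ0 : ∀ r, 0 ≤ γ r)
    (hγδ : ∀ r, δ ≤ r → γ r = 0) (hint : Integrable (fun h : 𝔼 => γ ‖h‖))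
    {F : Type*} [NormedAddCommGroup F] [NormedSpace ℝ F]
    {g : 𝔼 → F} (hg : Continuous g) : Integrable (fun h => γ ‖h‖ • g h) := by
  obtain ⟨C, hC⟩ := (isCompact_closedBall (0:𝔼) δ).exists_bound_of_continuousOn hg.continuousOn
  exact lps_int hγ0 hγδ hint hg.aestronglyMeasurable (C := C) (fun h hh => hC h (by simpa using hh))

lemma lps_bound {δ : ℝ} {γ : ℝ → ℝ} (hγ0 : ∀ r, 0 ≤ γ r)
    (hγδ : ∀ r, δ ≤ r → γ r = 0) (hint : Integrable (fun h : 𝔼 => γ ‖h‖))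
    {F : Type*} [NormedAddCommGroup F] [NormedSpace ℝ F]
    {g : 𝔼 → F} {K : ℝ} (hC : ∀ h, ‖h‖ ≤ δ → ‖g h‖ ≤ K * ‖h‖ ^ 2) :
    ‖∫ h, γ ‖h‖ • g h‖ ≤ K * ∫ h : 𝔼, γ ‖h‖ * ‖h‖ ^ 2 := by
  have hi : Integrable (fun h : 𝔼 => γ ‖h‖ * ‖h‖ ^ 2) := by
    simpa using lps_cont hγ0 hγδ hint (g := fun h : 𝔼 => ‖h‖ ^ 2) (by fun_prop)
  rw [← integral_const_mul]
  refine norm_integral_le_of_norm_le (hi.const_mul K) (.of_forall fun h => ?_)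
  rw [norm_smul, Real.norm_of_nonneg (hγ0 _)]
  by_cases hh : δ ≤ ‖h‖
  · simp [hγδ _ hh]
  · have := mul_le_mul_of_nonneg_left (hC h (not_le.1 hh).le) (hγ0 ‖h‖)
    linarith

lemma lps_sym {γ : ℝ → ℝ}
    {F : Type*} [NormedAddCommGroup F] [NormedSpace ℝ F]
    {g : 𝔼 → F} (hg : Integrable (fun h => γ ‖h‖ • g h)) :
    ∫ h, γ ‖h‖ • g h = (1/2 : ℝ) • ∫ h, γ ‖h‖ • (g h + g (-h)) := by
  have h1 : ∫ h : 𝔼, γ ‖h‖ • g (-h) = ∫ h, γ ‖h‖ • g h := by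
    have := integral_neg_eq_self (fun h : 𝔼 => γ ‖h‖ • g h) volume
    simpa using this
  have h2 : Integrable (fun h : 𝔼 => γ ‖h‖ • g (-h)) := by
    have := hg.comp_neg
    simpa using this
  simp only [smul_add]
  rw [integral_add hg h2, h1, ← two_smul ℝ, smul_smul]
  norm_num

/-- The reflection with matrix `[[a, b], [b, -a]]`. -/
noncomputable def lpsRefl (a b : ℝ) (hab : a ^ 2 + b ^ 2 = 1) : 𝔼 ≃ₗᵢ[ℝ] 𝔼 where
  toFun h := !₂[a * h 0 + b * h 1, b * h 0 - a * h 1]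
  invFun h := !₂[a * h 0 + b * h 1, b * h 0 - a * h 1]
  map_add' x y := by ext i; fin_cases i <;> simp <;> ring
  map_smul' c x := by ext i; fin_cases i <;> simp <;> ring
  left_inv x := by
    ext i; fin_cases i <;> simp
    · linear_combination (x 0) * hab
    · linear_combination (x 1) * hab
  right_inv x := by
    ext i; fin_cases i <;> simp
    · linear_combination (x 0) * hab
    · linear_combination (x 1) * hab
  norm_map' x := by
    simp [EuclideanSpace.norm_eq]
    congr 1
    linear_combination (x 0 ^ 2 + x 1 ^ 2) * hab

lemma lps_inv (γ : ℝ → ℝ) (f : ℝ → ℝ → ℝ → ℝ) (a b : ℝ) (hab : a ^ 2 + b ^ 2 = 1) :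
    ∫ h : 𝔼, γ ‖h‖ * f (a * h 0 + b * h 1) (b * h 0 - a * h 1) ‖h‖ =
      ∫ h : 𝔼, γ ‖h‖ * f (h 0) (h 1) ‖h‖ := by
  have := (lpsRefl a b hab).measurePreserving.integral_comp
    (lpsRefl a b hab).toHomeomorph.measurableEmbedding
    (fun h : 𝔼 => γ ‖h‖ * f (h 0) (h 1) ‖h‖)
  rw [← this]
  simp only [LinearIsometryEquiv.norm_map]
  rfl

lemma lps_nsq (h : 𝔼) : ‖h‖ ^ 2 = h 0 ^ 2 + h 1 ^ 2 := by
  simp [EuclideanSpace.norm_sq_eq]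

lemma lps_abs (h : 𝔼) (i : Fin 2) : |h i| ≤ ‖h‖ := by
  simpa using PiLp.norm_apply_le h i

lemma lps_comp {f : 𝔼 → 𝔼} (hf : Integrable f) (i : Fin 2) : (∫ h, f h) i = ∫ h, f h i :=
  ((EuclideanSpace.proj i : 𝔼 →L[ℝ] ℝ).integral_comp_comm hf).symm

lemma lps_lin5 {f1 f2 f3 f4 f5 : 𝔼 → ℝ} (i1 : Integrable f1) (i2 : Integrable f2)
    (i3 : Integrable f3) (i4 : Integrable f4) (i5 : Integrable f5) {a b c d e : ℝ} :
    ∫ h, (((a * f1 h + b * f2 h) + c * f3 h) + d * f4 h) + e * f5 h =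
      a * (∫ h, f1 h) + b * (∫ h, f2 h) + c * (∫ h, f3 h) + d * (∫ h, f4 h) + e * ∫ h, f5 h := by
  rw [integral_add (by exact ((((i1.const_mul _).add (i2.const_mul _)).add (i3.const_mul _)).add
      (i4.const_mul _))) (i5.const_mul _),
    integral_add (by exact (((i1.const_mul _).add (i2.const_mul _)).add (i3.const_mul _)))
      (i4.const_mul _),
    integral_add (by exact ((i1.const_mul _).add (i2.const_mul _))) (i3.const_mul _),
    integral_add (i1.const_mul _) (i2.const_mul _)]
  simp only [integral_const_mul]

lemma lps_int2 {δ : ℝ} {γ : ℝ → ℝ} (hγ0 : ∀ r, 0 ≤ γ r)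
    (hγδ : ∀ r, δ ≤ r → γ r = 0) (hint : Integrable (fun h : 𝔼 => γ ‖h‖))
    (i j : Fin 2) : Integrable (fun h : 𝔼 => γ ‖h‖ * (h i * h j)) := by
  simpa using lps_cont hγ0 hγδ hint (g := fun h : 𝔼 => h i * h j) (by fun_prop)

lemma lps_int4 {δ : ℝ} {γ : ℝ → ℝ} (hγ0 : ∀ r, 0 ≤ γ r)
    (hγδ : ∀ r, δ ≤ r → γ r = 0) (hint : Integrable (fun h : 𝔼 => γ ‖h‖))
    (i j k l : Fin 2) :
    Integrable (fun h : 𝔼 => γ ‖h‖ * (h i * h j * h k * h l / ‖h‖ ^ 2)) := by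
  refine lps_int hγ0 hγδ hint (g := fun h : 𝔼 => h i * h j * h k * h l / ‖h‖ ^ 2) (C := δ ^ 2)
    (Measurable.aestronglyMeasurable (by fun_prop)) (fun h hh => ?_)
  rw [Real.norm_eq_abs, abs_div, abs_mul, abs_mul, abs_mul, abs_of_nonneg (sq_nonneg ‖h‖)]
  refine div_le_of_le_mul₀ (sq_nonneg _) (sq_nonneg _) ?_
  have h1 : |h i| * |h j| * |h k| * |h l| ≤ ‖h‖ * ‖h‖ * ‖h‖ * ‖h‖ := by
    gcongr <;> exact lps_abs h _
  have h2 : ‖h‖ ^ 2 ≤ δ ^ 2 := by gcongr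
  nlinarith [sq_nonneg ‖h‖]

lemma lps_mom2 {δ m : ℝ} {γ : ℝ → ℝ} (hγ0 : ∀ r, 0 ≤ γ r)
    (hγδ : ∀ r, δ ≤ r → γ r = 0) (hint : Integrable (fun h : 𝔼 => γ ‖h‖))
    (hm : (∫ h : 𝔼, γ ‖h‖ * ‖h‖ ^ 2) = m)
    : ∫ h : 𝔼, γ ‖h‖ * (h 0 * h 0) = m / 2 ∧ ∫ h : 𝔼, γ ‖h‖ * (h 1 * h 1) = m / 2 ∧
    ∫ h : 𝔼, γ ‖h‖ * (h 0 * h 1) = 0 := by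
  have e1 := lps_inv γ (fun a b _ => a * a) 0 1 (by norm_num)
  have e2 := lps_inv γ (fun a b _ => a * b) 1 0 (by norm_num)
  simp only [zero_mul, one_mul, zero_add, add_zero, zero_sub, sub_zero, mul_neg,
    integral_neg] at e1 e2
  have e3 : ∫ h : 𝔼, γ ‖h‖ * (h 0 * h 0) + γ ‖h‖ * (h 1 * h 1) = m := by
    rw [← hm]; congr 1; ext h; rw [lps_nsq]; ring
  rw [integral_add (lps_int2 hγ0 hγδ hint 0 0) (lps_int2 hγ0 hγδ hint 1 1)] at e3
  refine ⟨by linarith, by linarith, by linarith⟩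

lemma lps_mom4 {δ m : ℝ} {γ : ℝ → ℝ} (hγ0 : ∀ r, 0 ≤ γ r)
    (hγδ : ∀ r, δ ≤ r → γ r = 0) (hint : Integrable (fun h : 𝔼 => γ ‖h‖))
    (hm : (∫ h : 𝔼, γ ‖h‖ * ‖h‖ ^ 2) = m)
    : ∫ h : 𝔼, γ ‖h‖ * (h 0 * h 0 * h 0 * h 0 / ‖h‖ ^ 2) = 3 * m / 8 ∧
    ∫ h : 𝔼, γ ‖h‖ * (h 1 * h 1 * h 1 * h 1 / ‖h‖ ^ 2) = 3 * m / 8 ∧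
    ∫ h : 𝔼, γ ‖h‖ * (h 0 * h 0 * h 1 * h 1 / ‖h‖ ^ 2) = m / 8 ∧
    ∫ h : 𝔼, γ ‖h‖ * (h 0 * h 0 * h 0 * h 1 / ‖h‖ ^ 2) = 0 ∧
    ∫ h : 𝔼, γ ‖h‖ * (h 0 * h 1 * h 1 * h 1 / ‖h‖ ^ 2) = 0 := by
  have i1 := lps_int4 hγ0 hγδ hint 0 0 0 0
  have i2 := lps_int4 hγ0 hγδ hint 1 1 1 1
  have i3 := lps_int4 hγ0 hγδ hint 0 0 1 1
  have i4 := lps_int4 hγ0 hγδ hint 0 0 0 1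
  have i5 := lps_int4 hγ0 hγδ hint 0 1 1 1
  have e1 := lps_inv γ (fun a b r => a * a * a * a / r ^ 2) 0 1 (by norm_num)
  have e2 := lps_inv γ (fun a b r => a * a * a * b / r ^ 2) 1 0 (by norm_num)
  have e3 := lps_inv γ (fun a b r => a * b * b * b / r ^ 2) 1 0 (by norm_num)
  have e4 := lps_inv γ (fun a b r => a * a * a * a / r ^ 2) (3/5) (4/5) (by norm_num)
  simp only [zero_mul, one_mul, zero_add, add_zero, zero_sub, sub_zero, mul_neg, neg_mul, neg_neg,
    neg_div, integral_neg] at e1 e2 e3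
  have e5 : ∫ h : 𝔼, (γ ‖h‖ * (h 0 * h 0 * h 0 * h 0 / ‖h‖ ^ 2) +
      2 * (γ ‖h‖ * (h 0 * h 0 * h 1 * h 1 / ‖h‖ ^ 2))) +
      γ ‖h‖ * (h 1 * h 1 * h 1 * h 1 / ‖h‖ ^ 2) = m := by
    rw [← hm]; congr 1; ext h
    by_cases hh : h = 0
    · simp [hh]
    have : ‖h‖ ^ 2 ≠ 0 := by simpa using hh
    field_simp
    have e := lps_nsq h
    rw [show ‖h‖ ^ 4 = (‖h‖ ^ 2) ^ 2 by ring, e]; ring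
  rw [integral_add (by exact i1.add (i3.const_mul 2)) i2, integral_add i1 (i3.const_mul 2),
    integral_const_mul] at e5
  have e6 : ∫ h : 𝔼, γ ‖h‖ * ((3/5 * h 0 + 4/5 * h 1) * (3/5 * h 0 + 4/5 * h 1) *
      (3/5 * h 0 + 4/5 * h 1) * (3/5 * h 0 + 4/5 * h 1) / ‖h‖ ^ 2) =
      ∫ h : 𝔼, ((((81/625) * (γ ‖h‖ * (h 0 * h 0 * h 0 * h 0 / ‖h‖ ^ 2)) +
      (432/625) * (γ ‖h‖ * (h 0 * h 0 * h 0 * h 1 / ‖h‖ ^ 2))) +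
      (864/625) * (γ ‖h‖ * (h 0 * h 0 * h 1 * h 1 / ‖h‖ ^ 2))) +
      (768/625) * (γ ‖h‖ * (h 0 * h 1 * h 1 * h 1 / ‖h‖ ^ 2))) +
      (256/625) * (γ ‖h‖ * (h 1 * h 1 * h 1 * h 1 / ‖h‖ ^ 2)) := by
    congr 1; ext h; ring
  rw [e6, lps_lin5 i1 i4 i3 i5 i2] at e4
  refine ⟨?_, ?_, ?_, ?_, ?_⟩ <;> linarith

lemma lps_vec2 {δ m : ℝ} {γ : ℝ → ℝ} (hγ0 : ∀ r, 0 ≤ γ r)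
    (hγδ : ∀ r, δ ≤ r → γ r = 0) (hint : Integrable (fun h : 𝔼 => γ ‖h‖))
    (hm : (∫ h : 𝔼, γ ‖h‖ * ‖h‖ ^ 2) = m)
    (a : 𝔼) : ∫ h : 𝔼, γ ‖h‖ • (⟪a, h⟫ • h) = (m / 2) • a := by
  obtain ⟨h1, h2, h3⟩ := lps_mom2 hγ0 hγδ hint hm
  have hi := lps_cont hγ0 hγδ hint (g := fun h : 𝔼 => ⟪a, h⟫ • h) (by fun_prop)
  have j1 := lps_int2 hγ0 hγδ hint 0 0
  have j2 := lps_int2 hγ0 hγδ hint 1 1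
  have j3 := lps_int2 hγ0 hγδ hint 0 1
  ext i
  rw [lps_comp hi]
  fin_cases i
  · have e : (fun h : 𝔼 => (γ ‖h‖ • (⟪a, h⟫ • h)) 0) = fun h : 𝔼 =>
        a 0 * (γ ‖h‖ * (h 0 * h 0)) + a 1 * (γ ‖h‖ * (h 0 * h 1)) := by
      ext h; simp [PiLp.inner_apply]; ring
    simp only [Fin.zero_eta, Fin.mk_one]
    rw [e, integral_add (j1.const_mul _) (j3.const_mul _)]
    simp only [integral_const_mul, h1, h3, PiLp.smul_apply, smul_eq_mul]
    ring
  · have e : (fun h : 𝔼 => (γ ‖h‖ • (⟪a, h⟫ • h)) 1) = fun h : 𝔼 =>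
        a 0 * (γ ‖h‖ * (h 0 * h 1)) + a 1 * (γ ‖h‖ * (h 1 * h 1)) := by
      ext h; simp [PiLp.inner_apply]; ring
    simp only [Fin.zero_eta, Fin.mk_one]
    rw [e, integral_add (j3.const_mul _) (j2.const_mul _)]
    simp only [integral_const_mul, h2, h3, PiLp.smul_apply, smul_eq_mul]
    ring

lemma lps_vec4 {δ m : ℝ} {γ : ℝ → ℝ} (hγ0 : ∀ r, 0 ≤ γ r)
    (hγδ : ∀ r, δ ≤ r → γ r = 0) (hint : Integrable (fun h : 𝔼 => γ ‖h‖))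
    (hm : (∫ h : 𝔼, γ ‖h‖ * ‖h‖ ^ 2) = m)
    (B : 𝔼 →L[ℝ] 𝔼 →L[ℝ] 𝔼) (hB : ∀ v w, B v w = B w v) (w : 𝔼)
    (hw : ∀ v, ⟪w, v⟫ = ∑ i : Fin 2, ⟪B v (EuclideanSpace.single i 1), EuclideanSpace.single i 1⟫) :
    ∫ h : 𝔼, γ ‖h‖ • ((⟪h, B h h⟫ / ‖h‖ ^ 2) • h) = (m / 8) •
      ((∑ i : Fin 2, B (EuclideanSpace.single i 1) (EuclideanSpace.single i 1)) + (2:ℝ) • w) := by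
  obtain ⟨h1, h2, h3, h4, h5⟩ := lps_mom4 hγ0 hγδ hint hm
  have i1 := lps_int4 hγ0 hγδ hint 0 0 0 0
  have i2 := lps_int4 hγ0 hγδ hint 1 1 1 1
  have i3 := lps_int4 hγ0 hγδ hint 0 0 1 1
  have i4 := lps_int4 hγ0 hγδ hint 0 0 0 1
  have i5 := lps_int4 hγ0 hγδ hint 0 1 1 1
  have hi : Integrable (fun h : 𝔼 => γ ‖h‖ • ((⟪h, B h h⟫ / ‖h‖ ^ 2) • h)) := by
    refine lps_int hγ0 hγδ hint (C := ‖B‖ * δ * δ)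
      (g := fun h : 𝔼 => (⟪h, B h h⟫ / ‖h‖ ^ 2) • h)
      (Measurable.aestronglyMeasurable (by fun_prop)) (fun h hh => ?_)
    by_cases h0 : h = 0
    · simp only [h0, smul_zero, norm_zero]
      have : 0 ≤ δ := (norm_nonneg _).trans hh
      positivity
    have hp : 0 < ‖h‖ := norm_pos_iff.2 h0
    have b1 := B.le_opNorm₂ h h
    have b2 := norm_inner_le_norm (𝕜 := ℝ) h (B h h)
    rw [norm_smul, norm_div, norm_pow, norm_norm, div_mul_eq_mul_div]
    rw [div_le_iff₀ (by positivity)]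
    calc ‖⟪h, B h h⟫‖ * ‖h‖ ≤ (‖h‖ * (‖B‖ * ‖h‖ * ‖h‖)) * ‖h‖ := by
          gcongr; exact b2.trans (by gcongr)
      _ = (‖B‖ * ‖h‖ * ‖h‖) * ‖h‖ ^ 2 := by ring
      _ ≤ _ := by
        have : 0 ≤ δ := (norm_nonneg _).trans hh
        gcongr
  have w0 := hw (EuclideanSpace.single 0 1)
  have w1 := hw (EuclideanSpace.single 1 1)
  have hdec : ∀ h : 𝔼, h = h 0 • EuclideanSpace.single 0 1 + h 1 • EuclideanSpace.single 1 1 := by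
    intro h; ext i; fin_cases i <;> simp
  have hq : ∀ h : 𝔼, ∀ i, B h h i = h 0 * h 0 * B (EuclideanSpace.single 0 1) (EuclideanSpace.single 0 1) i
      + 2 * (h 0 * h 1 * B (EuclideanSpace.single 0 1) (EuclideanSpace.single 1 1) i)
      + h 1 * h 1 * B (EuclideanSpace.single 1 1) (EuclideanSpace.single 1 1) i := by
    intro h i
    have : B h h = B (h 0 • EuclideanSpace.single 0 1 + h 1 • EuclideanSpace.single 1 1)
      (h 0 • EuclideanSpace.single 0 1 + h 1 • EuclideanSpace.single 1 1) := by rw [← hdec h]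
    rw [this]
    simp only [map_add, map_smul, _root_.add_apply, _root_.smul_apply,
      hB (EuclideanSpace.single 1 1) (EuclideanSpace.single 0 1), PiLp.add_apply, PiLp.smul_apply,
      smul_eq_mul]
    ring
  simp only [Fin.sum_univ_two, hB (EuclideanSpace.single 1 1) (EuclideanSpace.single 0 1)] at w0 w1
  simp [PiLp.inner_apply] at w0 w1
  rw [Fin.sum_univ_two]
  set b00 := B (EuclideanSpace.single 0 1) (EuclideanSpace.single 0 1)
  set b01 := B (EuclideanSpace.single 0 1) (EuclideanSpace.single 1 1)
  set b11 := B (EuclideanSpace.single 1 1) (EuclideanSpace.single 1 1)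
  ext i
  rw [lps_comp hi]
  have key : ∀ a b c d f : ℝ, ∫ h : 𝔼, (((a * (γ ‖h‖ * (h 0 * h 0 * h 0 * h 0 / ‖h‖ ^ 2)) +
      b * (γ ‖h‖ * (h 0 * h 0 * h 0 * h 1 / ‖h‖ ^ 2))) +
      c * (γ ‖h‖ * (h 0 * h 0 * h 1 * h 1 / ‖h‖ ^ 2))) +
      d * (γ ‖h‖ * (h 0 * h 1 * h 1 * h 1 / ‖h‖ ^ 2))) +
      f * (γ ‖h‖ * (h 1 * h 1 * h 1 * h 1 / ‖h‖ ^ 2)) = a * (3 * m / 8) + c * (m / 8)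
        + f * (3 * m / 8) := by
    intro a b c d f
    rw [lps_lin5 i1 i4 i3 i5 i2, h1, h2, h3, h4, h5]
    ring
  have hin : ∀ h : 𝔼, ⟪h, B h h⟫ = h 0 * B h h 0 + h 1 * B h h 1 := by
    intro h; simp [PiLp.inner_apply]; ring
  fin_cases i
  · have e : (fun h : 𝔼 => (γ ‖h‖ • ((⟪h, B h h⟫ / ‖h‖ ^ 2) • h)) 0) = fun h : 𝔼 =>
        (((b00 0 * (γ ‖h‖ * (h 0 * h 0 * h 0 * h 0 / ‖h‖ ^ 2)) +
        (2 * b01 0 + b00 1) * (γ ‖h‖ * (h 0 * h 0 * h 0 * h 1 / ‖h‖ ^ 2))) +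
        (b11 0 + 2 * b01 1) * (γ ‖h‖ * (h 0 * h 0 * h 1 * h 1 / ‖h‖ ^ 2))) +
        (b11 1) * (γ ‖h‖ * (h 0 * h 1 * h 1 * h 1 / ‖h‖ ^ 2))) +
        0 * (γ ‖h‖ * (h 1 * h 1 * h 1 * h 1 / ‖h‖ ^ 2)) := by
      funext h
      simp only [PiLp.smul_apply, smul_eq_mul, hin, hq]; ring
    simp only [Fin.zero_eta, Fin.mk_one]
    rw [e, key]
    simp [w0, w1]
    ring
  · have e : (fun h : 𝔼 => (γ ‖h‖ • ((⟪h, B h h⟫ / ‖h‖ ^ 2) • h)) 1) = fun h : 𝔼 =>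
        (((0 * (γ ‖h‖ * (h 0 * h 0 * h 0 * h 0 / ‖h‖ ^ 2)) +
        (b00 0) * (γ ‖h‖ * (h 0 * h 0 * h 0 * h 1 / ‖h‖ ^ 2))) +
        (2 * b01 0 + b00 1) * (γ ‖h‖ * (h 0 * h 0 * h 1 * h 1 / ‖h‖ ^ 2))) +
        (b11 0 + 2 * b01 1) * (γ ‖h‖ * (h 0 * h 1 * h 1 * h 1 / ‖h‖ ^ 2))) +
        b11 1 * (γ ‖h‖ * (h 1 * h 1 * h 1 * h 1 / ‖h‖ ^ 2)) := by
      funext h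
      simp only [PiLp.smul_apply, smul_eq_mul, hin, hq]; ring
    simp only [Fin.zero_eta, Fin.mk_one]
    rw [e, key]
    simp [w0, w1]
    ring

/-- The trace functional. -/
noncomputable def lpsTr : (𝔼 →L[ℝ] 𝔼) →L[ℝ] ℝ :=
  ∑ i : Fin 2, (innerSL ℝ (EuclideanSpace.single i (1:ℝ) : 𝔼)) ∘L
    (ContinuousLinearMap.apply ℝ 𝔼 (EuclideanSpace.single i (1:ℝ) : 𝔼))

lemma lpsTr_apply (T : 𝔼 →L[ℝ] 𝔼) : lpsTr T =
    ∑ i : Fin 2, ⟪T (EuclideanSpace.single i 1), EuclideanSpace.single i 1⟫ := by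
  simp [lpsTr, Fin.sum_univ_two, real_inner_comm]

lemma lpsTr_bound (T : 𝔼 →L[ℝ] 𝔼) : |lpsTr T| ≤ 2 * ‖T‖ := by
  rw [lpsTr_apply, Fin.sum_univ_two]
  have h : ∀ i : Fin 2, |⟪T (EuclideanSpace.single i 1), EuclideanSpace.single i 1⟫| ≤ ‖T‖ := by
    intro i
    have h1 := abs_real_inner_le_norm (T (EuclideanSpace.single i 1)) (EuclideanSpace.single i 1)
    have h2 := T.le_opNorm (EuclideanSpace.single i 1)
    simp only [PiLp.norm_single, norm_one, mul_one] at h1 h2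
    exact h1.trans h2
  refine (abs_add_le _ _).trans ?_
  linarith [h 0, h 1]

lemma lps_proj (h v : 𝔼) : ‖(⟪h, v⟫ / ‖h‖ ^ 2) • h‖ ≤ ‖v‖ := by
  by_cases h0 : h = 0
  · simp [h0]
  have hp : 0 < ‖h‖ := norm_pos_iff.2 h0
  rw [norm_smul, norm_div, norm_pow, norm_norm, div_mul_eq_mul_div, div_le_iff₀ (by positivity)]
  nlinarith [norm_inner_le_norm (𝕜 := ℝ) h v]

lemma lps_tr {δ m : ℝ} {γ : ℝ → ℝ} (hγ0 : ∀ r, 0 ≤ γ r)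
    (hγδ : ∀ r, δ ≤ r → γ r = 0) (hint : Integrable (fun h : 𝔼 => γ ‖h‖))
    (hm : (∫ h : 𝔼, γ ‖h‖ * ‖h‖ ^ 2) = m)
    (T : 𝔼 →L[ℝ] 𝔼) : ∫ h : 𝔼, γ ‖h‖ • ⟪h, T h⟫ = (m / 2) * lpsTr T := by
  obtain ⟨h1, h2, h3⟩ := lps_mom2 hγ0 hγδ hint hm
  have j1 := lps_int2 hγ0 hγδ hint 0 0
  have j2 := lps_int2 hγ0 hγδ hint 1 1
  have j3 := lps_int2 hγ0 hγδ hint 0 1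
  have hq : ∀ h : 𝔼, ∀ i, T h i = h 0 * T (EuclideanSpace.single 0 1) i
      + h 1 * T (EuclideanSpace.single 1 1) i := by
    intro h i
    have : h = h 0 • EuclideanSpace.single 0 1 + h 1 • EuclideanSpace.single 1 1 := by
      ext i; fin_cases i <;> simp
    have : T h = T (h 0 • EuclideanSpace.single 0 1 + h 1 • EuclideanSpace.single 1 1) := by
      rw [← this]
    rw [this]
    simp only [map_add, map_smul, PiLp.add_apply, PiLp.smul_apply, smul_eq_mul]
  have e : ∀ h : 𝔼, γ ‖h‖ • ⟪h, T h⟫ =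
      (((T (EuclideanSpace.single 0 1) 0 * (γ ‖h‖ * (h 0 * h 0))
      + (T (EuclideanSpace.single 1 1) 0 + T (EuclideanSpace.single 0 1) 1) *
        (γ ‖h‖ * (h 0 * h 1)))
      + T (EuclideanSpace.single 1 1) 1 * (γ ‖h‖ * (h 1 * h 1)))
      + 0 * (γ ‖h‖ * (h 1 * h 1))) + 0 * (γ ‖h‖ * (h 1 * h 1)) := by
    intro h
    have : ⟪h, T h⟫ = h 0 * T h 0 + h 1 * T h 1 := by simp [PiLp.inner_apply]; ring
    rw [this, hq h 0, hq h 1, smul_eq_mul]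
    ring
  simp_rw [e]
  rw [lps_lin5 j1 j3 j2 j2 j2, h1, h2, h3, lpsTr_apply]
  simp [PiLp.inner_apply, Fin.sum_univ_two]
  ring

lemma lps_theta {δ m : ℝ} {γ : ℝ → ℝ} (hγ0 : ∀ r, 0 ≤ γ r)
    (hγδ : ∀ r, δ ≤ r → γ r = 0) (hint : Integrable (fun h : 𝔼 => γ ‖h‖))
    (hm : (∫ h : 𝔼, γ ‖h‖ * ‖h‖ ^ 2) = m)
    (hm0 : 0 < m) {u : 𝔼 → 𝔼} (hu : ContDiff ℝ 4 u) (p : 𝔼) :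
    (2 / m) * ∫ y, γ ‖y - p‖ * ⟪y - p, u y - u p⟫ = lpsTr (fderiv ℝ u p) +
      (1 / m) * ∫ h, γ ‖h‖ • ⟪h, u (p + h) - u (p - h) - (2:ℝ) • fderiv ℝ u p h⟫ := by
  have hc : Continuous u := hu.continuous
  have e1 : ∫ y, γ ‖y - p‖ * ⟪y - p, u y - u p⟫ = ∫ h, γ ‖h‖ • ⟪h, u (p + h) - u p⟫ := by
    rw [← integral_sub_right_eq_self (fun h => γ ‖h‖ • ⟪h, u (p + h) - u p⟫) p]
    simp
  have e2 := lps_sym (lps_cont hγ0 hγδ hint (g := fun h : 𝔼 => ⟪h, u (p + h) - u p⟫)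
    (by fun_prop))
  have e3 : ∀ h : 𝔼, γ ‖h‖ • (⟪h, u (p + h) - u p⟫ + ⟪-h, u (p + -h) - u p⟫) =
      γ ‖h‖ • ⟪h, u (p + h) - u (p - h) - (2:ℝ) • fderiv ℝ u p h⟫ +
       2 * γ ‖h‖ • ⟪h, fderiv ℝ u p h⟫ := by
    intro h
    simp only [inner_sub_right, inner_neg_left, inner_smul_right, smul_eq_mul, ← sub_eq_add_neg]
    ring
  simp_rw [e3] at e2
  rw [integral_add (lps_cont hγ0 hγδ hint (by fun_prop))
    ((lps_cont hγ0 hγδ hint (by fun_prop)).const_mul 2), integral_const_mul,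
    lps_tr hγ0 hγδ hint hm] at e2
  rw [e1, e2, smul_eq_mul]
  field_simp
  ring

lemma lps_Elip {δ m : ℝ} {γ : ℝ → ℝ} (hγ0 : ∀ r, 0 ≤ γ r)
    (hγδ : ∀ r, δ ≤ r → γ r = 0) (hint : Integrable (fun h : 𝔼 => γ ‖h‖))
    (hm : (∫ h : 𝔼, γ ‖h‖ * ‖h‖ ^ 2) = m)
    (hm0 : 0 < m) {u : 𝔼 → 𝔼} (hu : ContDiff ℝ 4 u) {x : 𝔼} {M : ℝ} (hM : 0 ≤ M)
    (hb : ∀ z ∈ Metric.closedBall x (2 * δ), ‖iteratedFDeriv ℝ 4 u z‖ ≤ M)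
    {p q : 𝔼} (hp : p ∈ Metric.closedBall x δ) (hq : q ∈ Metric.closedBall x δ) :
    |(1 / m) * (∫ h, γ ‖h‖ • ⟪h, u (p + h) - u (p - h) - (2:ℝ) • fderiv ℝ u p h⟫) -
      (1 / m) * (∫ h, γ ‖h‖ • ⟪h, u (q + h) - u (q - h) - (2:ℝ) • fderiv ℝ u q h⟫)|
      ≤ 2 * M * δ ^ 2 * ‖p - q‖ := by
  have hc : Continuous u := hu.continuous
  rw [← mul_sub, ← integral_sub (lps_cont hγ0 hγδ hint (by fun_prop))
    (lps_cont hγ0 hγδ hint (by fun_prop))]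
  simp_rw [← smul_sub, ← inner_sub_right]
  have := lps_bound hγ0 hγδ hint (K := 2 * M * δ ^ 2 * ‖p - q‖)
    (g := fun h => ⟪h, (u (p + h) - u (p - h) - (2:ℝ) • fderiv ℝ u p h) -
      (u (q + h) - u (q - h) - (2:ℝ) • fderiv ℝ u q h)⟫) (fun h hh => by
      refine (norm_inner_le_norm _ _).trans ?_
      have h5 := lps_L5 hu hb hh hp hq
      calc _ ≤ ‖h‖ * (2 * M * ‖h‖ ^ 3 * ‖p - q‖) := by gcongr
        _ = 2 * M * ‖h‖ ^ 2 * ‖p - q‖ * ‖h‖ ^ 2 := by ring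
        _ ≤ _ := by gcongr)
  rw [hm, Real.norm_eq_abs] at this
  rw [abs_mul, abs_of_pos (by positivity : 0 < 1 / m), one_div, inv_mul_le_iff₀ hm0]
  linarith

lemma lps_T1 {δ m : ℝ} {γ : ℝ → ℝ} (hγ0 : ∀ r, 0 ≤ γ r)
    (hγδ : ∀ r, δ ≤ r → γ r = 0) (hint : Integrable (fun h : 𝔼 => γ ‖h‖))
    (hm : (∫ h : 𝔼, γ ‖h‖ * ‖h‖ ^ 2) = m)
    (hγ : Measurable γ) (hm0 : 0 < m) {u : 𝔼 → 𝔼} (hu : ContDiff ℝ 4 u) {x : 𝔼} {M : ℝ} (hM : 0 ≤ M)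
    (hb : ∀ z ∈ Metric.closedBall x (2 * δ), ‖iteratedFDeriv ℝ 4 u z‖ ≤ M)
    {θ : 𝔼 → ℝ} (hθ : ∀ p, θ p = (2 / m) * ∫ y, γ ‖y - p‖ * ⟪y - p, u y - u p⟫)
    {w : 𝔼} (hw : ∀ v, ⟪w, v⟫ = lpsTr (fderiv ℝ (fderiv ℝ u) x v)) :
    ‖(2 / m) • (∫ y, (γ ‖y - x‖ * (θ x + θ y)) • (y - x)) - w‖ ≤ 8 * M * δ ^ 2 := by
  have hc : Continuous u := hu.continuous
  have hc1 : Continuous (fderiv ℝ u) := hu.continuous_fderiv (by norm_num)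
  have hθm : Measurable θ := by
    have : θ = fun p => (2 / m) * ∫ y, γ ‖y - p‖ * ⟪y - p, u y - u p⟫ := funext hθ
    rw [this]
    refine Measurable.const_mul ?_ _
    have hmu := hc.measurable
    have : StronglyMeasurable
        (Function.uncurry fun p y : 𝔼 => γ ‖y - p‖ * ⟪y - p, u y - u p⟫) :=
      Measurable.stronglyMeasurable (by unfold Function.uncurry; fun_prop)
    exact this.integral_prod_right.measurable
  have e1 : ∫ y, (γ ‖y - x‖ * (θ x + θ y)) • (y - x) =
      ∫ h, γ ‖h‖ • ((θ x + θ (x + h)) • h) := by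
    rw [← integral_sub_right_eq_self (fun h => γ ‖h‖ • ((θ x + θ (x + h)) • h)) x]
    simp [mul_smul]
  have hE : ∀ {p q : 𝔼}, p ∈ Metric.closedBall x δ → q ∈ Metric.closedBall x δ →
      |(θ p - lpsTr (fderiv ℝ u p)) - (θ q - lpsTr (fderiv ℝ u q))| ≤
        2 * M * δ ^ 2 * ‖p - q‖ := by
    intro p q hp hq
    have := lps_Elip hγ0 hγδ hint hm hm0 hu hM hb hp hq
    rw [hθ p, hθ q, lps_theta hγ0 hγδ hint hm hm0 hu p, lps_theta hγ0 hγδ hint hm hm0 hu q,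
      add_sub_cancel_left, add_sub_cancel_left]
    exact this
  obtain ⟨C, hC⟩ := (isCompact_closedBall (0:𝔼) δ).exists_bound_of_continuousOn
    (f := fun h => lpsTr (fderiv ℝ u (x + h))) (by fun_prop)
  have hi : Integrable (fun h => γ ‖h‖ • ((θ x + θ (x + h)) • h)) := by
    refine lps_int hγ0 hγδ hint
      (C := (|θ x| + (2 * M * δ ^ 2 * δ + C + |θ x - lpsTr (fderiv ℝ u x)|)) * δ)
      (g := fun h => (θ x + θ (x + h)) • h)
      (Measurable.aestronglyMeasurable (by fun_prop)) (fun h hh => ?_)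
    have d0 : 0 ≤ δ := (norm_nonneg _).trans hh
    have h1 := hC h (by simpa using hh)
    have h2 := hE (p := x + h) (q := x) (by simpa using hh) (by simpa using d0)
    rw [add_sub_cancel_left] at h2
    have h3 : 2 * M * δ ^ 2 * ‖h‖ ≤ 2 * M * δ ^ 2 * δ := by gcongr
    rw [Real.norm_eq_abs] at h1
    have h4 : |θ (x + h)| ≤ 2 * M * δ ^ 2 * δ + C + |θ x - lpsTr (fderiv ℝ u x)| := by
      have e : θ (x + h) = ((θ (x + h) - lpsTr (fderiv ℝ u (x + h))) -
        (θ x - lpsTr (fderiv ℝ u x))) + lpsTr (fderiv ℝ u (x + h)) +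
        (θ x - lpsTr (fderiv ℝ u x)) := by ring
      rw [e]
      refine (abs_add_three _ _ _).trans ?_
      linarith
    rw [norm_smul, Real.norm_eq_abs]
    have h5 := (abs_add_le (θ x) (θ (x + h)))
    have h6 : |θ x + θ (x + h)| ≤
      |θ x| + (2 * M * δ ^ 2 * δ + C + |θ x - lpsTr (fderiv ℝ u x)|) := by linarith
    exact mul_le_mul h6 hh (norm_nonneg _) ((abs_nonneg _).trans h6)
  have e2 := lps_sym hi
  have e3 : ∀ h : 𝔼, γ ‖h‖ • ((θ x + θ (x + h)) • h + (θ x + θ (x + -h)) • -h) =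
      γ ‖h‖ • ((θ (x + h) - θ (x - h)) • h) := by
    intro h; rw [← sub_eq_add_neg]; module
  simp_rw [e3] at e2
  have hi2 : Integrable (fun h => γ ‖h‖ • ((θ (x + h) - θ (x - h)) • h)) := by
    have h2 := hi.comp_neg
    refine (hi.add h2).congr (.of_forall fun h => ?_)
    simp only [Pi.add_apply, norm_neg]
    rw [← e3 h, smul_add]
  have e4 : (2 / m) • (∫ y, (γ ‖y - x‖ * (θ x + θ y)) • (y - x)) - w =
      (1 / m) • ∫ h, γ ‖h‖ • ((θ (x + h) - θ (x - h) - 2 * ⟪w, h⟫) • h) := by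
    have : ∀ h, γ ‖h‖ • ((θ (x + h) - θ (x - h) - 2 * ⟪w, h⟫) • h) =
      γ ‖h‖ • ((θ (x + h) - θ (x - h)) • h) - (2:ℝ) • γ ‖h‖ • (⟪w, h⟫ • h) := by
      intro h; module
    simp_rw [this]
    rw [integral_sub hi2 (by exact (lps_cont hγ0 hγδ hint (by fun_prop)).smul (2:ℝ)), integral_smul,
      lps_vec2 hγ0 hγδ hint hm, e1, e2]
    match_scalars <;> field_simp
  rw [e4, norm_smul, Real.norm_of_nonneg (by positivity), one_div, inv_mul_le_iff₀ hm0]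
  have := lps_bound hγ0 hγδ hint (K := 8 * M * δ ^ 2)
    (g := fun h => (θ (x + h) - θ (x - h) - 2 * ⟪w, h⟫) • h) (fun h hh => by
      have d0 : 0 ≤ δ := (norm_nonneg _).trans hh
      have h1 := hE (p := x + h) (q := x - h) (by simpa using hh) (by simpa using hh)
      have e : (x + h) - (x - h) = (2:ℝ) • h := by rw [two_smul]; abel
      rw [e, norm_smul, Real.norm_ofNat] at h1
      have h2 := lps_L3 (G := fderiv ℝ u) (hu.fderiv_right (m := 3) (by norm_num)) (y := x) (h := h)
        (M := M) (fun z hz => norm_iteratedFDeriv_fderiv.le.trans <| hb z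
          (Metric.closedBall_subset_closedBall (by linarith) hz))
      have h3 := lpsTr_bound (fderiv ℝ u (x + h) - fderiv ℝ u (x - h)
        - (2:ℝ) • fderiv ℝ (fderiv ℝ u) x h)
      simp only [map_sub, map_smul, ← hw, smul_eq_mul] at h3
      have h4 : |θ (x + h) - θ (x - h) - 2 * ⟪w, h⟫| ≤ 8 * M * δ ^ 2 * ‖h‖ := by
        have e : θ (x + h) - θ (x - h) - 2 * ⟪w, h⟫ = ((θ (x + h) - lpsTr (fderiv ℝ u (x + h))) -
          (θ (x - h) - lpsTr (fderiv ℝ u (x - h)))) + (lpsTr (fderiv ℝ u (x + h)) -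
          lpsTr (fderiv ℝ u (x - h)) - 2 * ⟪w, h⟫) := by ring
        rw [e]
        refine (abs_add_le _ _).trans ?_
        have h5 : 2 * (2 * M * ‖h‖ ^ 3) ≤ 4 * M * δ ^ 2 * ‖h‖ := by
          calc _ = 4 * M * ‖h‖ ^ 2 * ‖h‖ := by ring
            _ ≤ _ := by gcongr
        linarith
      rw [norm_smul, Real.norm_eq_abs]
      calc _ ≤ 8 * M * δ ^ 2 * ‖h‖ * ‖h‖ := by gcongr
        _ = _ := by ring)
  rw [hm] at this
  linarith

lemma lps_T2 {δ m : ℝ} {γ : ℝ → ℝ} (hγ0 : ∀ r, 0 ≤ γ r)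
    (hγδ : ∀ r, δ ≤ r → γ r = 0) (hint : Integrable (fun h : 𝔼 => γ ‖h‖))
    (hm : (∫ h : 𝔼, γ ‖h‖ * ‖h‖ ^ 2) = m)
    (hm0 : 0 < m) {u : 𝔼 → 𝔼} (hu : ContDiff ℝ 4 u) {x : 𝔼} {M : ℝ} (hM : 0 ≤ M)
    (hb : ∀ z ∈ Metric.closedBall x (2 * δ), ‖iteratedFDeriv ℝ 4 u z‖ ≤ M)
    {w : 𝔼} (hw : ∀ v, ⟪w, v⟫ = lpsTr (fderiv ℝ (fderiv ℝ u) x v)) :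
    ‖(16 / m) • (∫ y, (γ ‖y - x‖ * (⟪y - x, u y - u x⟫ / ‖y - x‖ ^ 2)) • (y - x)) -
      ((∑ i : Fin 2, fderiv ℝ (fderiv ℝ u) x (EuclideanSpace.single i 1)
        (EuclideanSpace.single i 1)) + (2:ℝ) • w)‖ ≤ 16 * M * δ ^ 2 := by
  have hc : Continuous u := hu.continuous
  have hmu := hc.measurable
  have e1 : ∫ y, (γ ‖y - x‖ * (⟪y - x, u y - u x⟫ / ‖y - x‖ ^ 2)) • (y - x) =
      ∫ h, γ ‖h‖ • ((⟪h, u (x + h) - u x⟫ / ‖h‖ ^ 2) • h) := by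
    rw [← integral_sub_right_eq_self
      (fun h => γ ‖h‖ • ((⟪h, u (x + h) - u x⟫ / ‖h‖ ^ 2) • h)) x]
    simp [mul_smul]
  have hI : ∀ v : 𝔼 → 𝔼, Continuous v →
      Integrable (fun h => γ ‖h‖ • ((⟪h, v h⟫ / ‖h‖ ^ 2) • h)) := by
    intro v hv
    obtain ⟨C, hC⟩ := (isCompact_closedBall (0:𝔼) δ).exists_bound_of_continuousOn hv.continuousOn
    have := hv.measurable
    exact lps_int hγ0 hγδ hint (g := fun h => (⟪h, v h⟫ / ‖h‖ ^ 2) • h)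
      (Measurable.aestronglyMeasurable (by fun_prop)) (C := C)
      (fun h hh => (lps_proj _ _).trans (hC h (by simpa using hh)))
  have e2 := lps_sym (hI (fun h => u (x + h) - u x) (by fun_prop))
  have e3 : ∀ h : 𝔼, γ ‖h‖ • ((⟪h, u (x + h) - u x⟫ / ‖h‖ ^ 2) • h +
      (⟪-h, u (x + -h) - u x⟫ / ‖-h‖ ^ 2) • -h) =
      γ ‖h‖ • ((⟪h, u (x + h) + u (x - h) - (2:ℝ) • u x
        - fderiv ℝ (fderiv ℝ u) x h h⟫ / ‖h‖ ^ 2) • h) +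
      γ ‖h‖ • ((⟪h, fderiv ℝ (fderiv ℝ u) x h h⟫ / ‖h‖ ^ 2) • h) := by
    intro h
    rw [← sub_eq_add_neg, norm_neg]
    simp only [inner_sub_right, inner_add_right, inner_neg_left, inner_smul_right]
    match_scalars
    ring
  simp_rw [e3] at e2
  rw [integral_add (hI _ (by fun_prop)) (hI _ (by fun_prop)),
    lps_vec4 hγ0 hγδ hint hm _ (fun v w => lps_symm (hu.of_le (by norm_num)) x v w) w
      (fun v => by rw [hw, lpsTr_apply])] at e2
  have e4 : (16 / m) • (∫ y, (γ ‖y - x‖ * (⟪y - x, u y - u x⟫ / ‖y - x‖ ^ 2)) • (y - x)) -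
      ((∑ i : Fin 2, fderiv ℝ (fderiv ℝ u) x (EuclideanSpace.single i 1)
        (EuclideanSpace.single i 1)) + (2:ℝ) • w) = (8 / m) •
      ∫ h, γ ‖h‖ • ((⟪h, u (x + h) + u (x - h) - (2:ℝ) • u x
        - fderiv ℝ (fderiv ℝ u) x h h⟫ / ‖h‖ ^ 2) • h) := by
    rw [e1, e2]
    generalize (∑ i : Fin 2, fderiv ℝ (fderiv ℝ u) x (EuclideanSpace.single i 1)
        (EuclideanSpace.single i 1)) = S
    match_scalars <;> field_simp <;> norm_num
  have := lps_bound hγ0 hγδ hint (K := 2 * M * δ ^ 2)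
    (g := fun h => (⟪h, u (x + h) + u (x - h) - (2:ℝ) • u x
        - fderiv ℝ (fderiv ℝ u) x h h⟫ / ‖h‖ ^ 2) • h) (fun h hh => by
      refine (lps_proj _ _).trans ?_
      have d0 : 0 ≤ δ := (norm_nonneg _).trans hh
      refine (lps_L4 hu (M := M) (fun z hz => hb z
          (Metric.closedBall_subset_closedBall (by linarith) hz))).trans ?_
      calc _ = 2 * M * ‖h‖ ^ 2 * ‖h‖ ^ 2 := by ring
        _ ≤ _ := by gcongr)
  rw [hm] at this
  rw [e4, norm_smul, Real.norm_of_nonneg (by positivity), div_mul_eq_mul_div, div_le_iff₀ hm0]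
  linarith

/-- Pointwise consistency of the LPS operator with the local Navier operator
(eq. (2.9)): there is a universal constant `c > 0` such that for every horizon `δ`,
kernel `γ`, Lamé parameters `λ, μ`, and `C⁴` displacement field `u` with derivatives
up to fourth order bounded by `M` on the ball of radius `2δ` about `x`,
`‖ℒ^{LPS}u(x) − (μ Δu(x) + (λ+μ) ∇(∇·u)(x))‖ ≤ c (|λ−μ| + |μ|) M δ²`. -/
theorem lps_pointwise_consistency_with_navier :
    ∃ c : ℝ, 0 < c ∧
      ∀ (δ : ℝ), 0 < δ →
      ∀ (lam mu : ℝ) (γ : ℝ → ℝ), Measurable γ → (∀ r, 0 ≤ γ r) →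
        (∀ r, δ ≤ r → γ r = 0) →
        Integrable (fun h : EuclideanSpace ℝ (Fin 2) => γ ‖h‖) →
      ∀ m : ℝ, 0 < m → (∫ h : EuclideanSpace ℝ (Fin 2), γ ‖h‖ * ‖h‖ ^ 2) = m →
      ∀ u : EuclideanSpace ℝ (Fin 2) → EuclideanSpace ℝ (Fin 2), ContDiff ℝ 4 u →
      ∀ (x : EuclideanSpace ℝ (Fin 2)) (M : ℝ), 0 ≤ M →
        (∀ z ∈ Metric.closedBall x (2 * δ), ∀ k : ℕ, 1 ≤ k → k ≤ 4 →
          ‖iteratedFDeriv ℝ k u z‖ ≤ M) →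
      ∀ θ : EuclideanSpace ℝ (Fin 2) → ℝ,
        (∀ p, θ p = (2 / m) * ∫ y, γ ‖y - p‖ * ⟪y - p, u y - u p⟫) →
        ‖(((2 * (lam - mu)) / m) • (∫ y, (γ ‖y - x‖ * (θ x + θ y)) • (y - x)) +
            ((16 * mu) / m) •
              (∫ y, (γ ‖y - x‖ * (⟪y - x, u y - u x⟫ / ‖y - x‖ ^ 2)) • (y - x))) -
          (mu • (∑ i : Fin 2, iteratedFDeriv ℝ 2 u x
              ![EuclideanSpace.single i 1, EuclideanSpace.single i 1]) +
            (lam + mu) • gradient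
              (fun p => ∑ i : Fin 2,
                ⟪fderiv ℝ u p (EuclideanSpace.single i 1), EuclideanSpace.single i 1⟫) x)‖ ≤
          c * (|lam - mu| + |mu|) * M * δ ^ 2 := by
  refine ⟨16, by norm_num, ?_⟩
  intro δ hδ lam mu γ hγ hγ0 hγδ hint m hm0 hm u hu x M hM hb θ hθ
  have hb4 : ∀ z ∈ Metric.closedBall x (2 * δ), ‖iteratedFDeriv ℝ 4 u z‖ ≤ M :=
    fun z hz => hb z hz 4 (by norm_num) le_rfl
  have hd1 : Differentiable ℝ (fderiv ℝ u) :=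
    (hu.fderiv_right (m := 3) (by norm_num)).differentiable (by norm_num)
  set w := gradient (fun p => ∑ i : Fin 2,
    ⟪fderiv ℝ u p (EuclideanSpace.single i 1), EuclideanSpace.single i 1⟫) x with hwdef
  have hw : ∀ v, ⟪w, v⟫ = lpsTr (fderiv ℝ (fderiv ℝ u) x v) := by
    intro v
    rw [hwdef]
    simp_rw [← lpsTr_apply]
    rw [gradient, InnerProductSpace.toDual_symm_apply]
    have := (lpsTr.hasFDerivAt.comp x (hd1 x).hasFDerivAt).fderiv
    rw [Function.comp_def] at this
    rw [this]
    rfl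
  have T1 := lps_T1 hγ0 hγδ hint hm hγ hm0 hu hM hb4 hθ hw
  have T2 := lps_T2 hγ0 hγδ hint hm hm0 hu hM hb4 hw
  simp only [iteratedFDeriv_two_apply, Matrix.cons_val_zero, Matrix.cons_val_one]
  set I1 := ∫ y, (γ ‖y - x‖ * (θ x + θ y)) • (y - x)
  set I2 := ∫ y, (γ ‖y - x‖ * (⟪y - x, u y - u x⟫ / ‖y - x‖ ^ 2)) • (y - x)
  set S := ∑ i : Fin 2, fderiv ℝ (fderiv ℝ u) x (EuclideanSpace.single i 1)
        (EuclideanSpace.single i 1)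
  have e : (2 * (lam - mu) / m) • I1 + (16 * mu / m) • I2 - (mu • S + (lam + mu) • w) =
      (lam - mu) • ((2 / m) • I1 - w) + mu • ((16 / m) • I2 - (S + (2:ℝ) • w)) := by
    match_scalars <;> ring
  rw [e]
  refine (norm_add_le _ _).trans ?_
  rw [norm_smul, norm_smul, Real.norm_eq_abs, Real.norm_eq_abs]
  have h1 := mul_le_mul_of_nonneg_left T1 (abs_nonneg (lam - mu))
  have h2 := mul_le_mul_of_nonneg_left T2 (abs_nonneg mu)
  have h3 : 0 ≤ |lam - mu| * (8 * M * δ ^ 2) := by positivity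
  linarith
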